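/- Inversion formula for the fractional windowed Wigner transform: let θ ∈ ℝ and let φ be a Schwartz function on ℝ^n with ‖φ‖_{L²(ℝ^n)} = 1. Define W^θ_φ ψ = U(θ)(ψ ⊗ conj φ̂) and ((W^θ_φ)^* Ψ)(x) = ∫_{ℝ^n} φ̂(p) (U(−θ)Ψ)(x,p) dp. Then for every Schwartz ψ on ℝ^n and every x ∈ ℝ^n, ((W^θ_φ)^* (W^θ_φ ψ))(x) = ψ(x). -/

import Mathlib

open MeasureTheory Real SchwartzMap
open scoped InnerProductSpace ComplexConjugate

noncomputable section

/-- `ℝ^n` as a Euclidean space. -/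
abbrev En (n : ℕ) := EuclideanSpace ℝ (Fin n)

/-- The linear flow `M(θ)` on `ℝ^n × ℝ^n` (with `k = √7`). -/
def Mflow (n : ℕ) (θ : ℝ) (z : En n × En n) : En n × En n :=
  ((Real.cos (Real.sqrt 7 * θ) - (Real.sqrt 7)⁻¹ * Real.sin (Real.sqrt 7 * θ)) • z.1
     + (2 * (Real.sqrt 7)⁻¹ * Real.sin (Real.sqrt 7 * θ)) • z.2,
   (-(4 * (Real.sqrt 7)⁻¹ * Real.sin (Real.sqrt 7 * θ))) • z.1
     + (Real.cos (Real.sqrt 7 * θ) + (Real.sqrt 7)⁻¹ * Real.sin (Real.sqrt 7 * θ)) • z.2)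

/-- The special parameter value `θ₀ = (1/√7)·arccos(3/4)`. -/
def θ₀ : ℝ := (Real.sqrt 7)⁻¹ * Real.arccos (3 / 4)

/-- The Fourier transform `φ̂(p) = (2π)^{-n/2} ∫ e^{-i p·y} φ(y) dy`. -/
def FT (n : ℕ) (φ : En n → ℂ) (p : En n) : ℂ :=
  (((2 * Real.pi) ^ (-(n : ℝ) / 2) : ℝ) : ℂ) *
    ∫ y : En n, Complex.exp (-(Complex.I * (⟪p, y⟫_ℝ : ℂ))) * φ y

/-- Partial Fourier transform in the second variable. -/
def F2 (n : ℕ) (Ψ : En n × En n → ℂ) (z : En n × En n) : ℂ :=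
  (((2 * Real.pi) ^ (-(n : ℝ) / 2) : ℝ) : ℂ) *
    ∫ p : En n, Complex.exp (-(Complex.I * (⟪z.2, p⟫_ℝ : ℂ))) * Ψ (z.1, p)

/-- Inverse partial Fourier transform in the second variable. -/
def F2inv (n : ℕ) (Ψ : En n × En n → ℂ) (z : En n × En n) : ℂ :=
  (((2 * Real.pi) ^ (-(n : ℝ) / 2) : ℝ) : ℂ) *
    ∫ ξ : En n, Complex.exp (Complex.I * (⟪ξ, z.2⟫_ℝ : ℂ)) * Ψ (z.1, ξ)

/-- The operator `U(θ) = F₂⁻¹ ∘ T(θ) ∘ F₂`, where `T(θ)Φ = Φ ∘ M(-θ)`. -/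
def Uop (n : ℕ) (θ : ℝ) (Ψ : En n × En n → ℂ) : En n × En n → ℂ :=
  F2inv n (fun z => F2 n Ψ (Mflow n (-θ) z))

/-- The cross Wigner function. -/
def Wig (n : ℕ) (ψ φ : En n → ℂ) (z : En n × En n) : ℂ :=
  (((2 * Real.pi) ^ (-(n : ℝ)) : ℝ) : ℂ) *
    ∫ ξ : En n, Complex.exp (Complex.I * (⟪z.2, ξ⟫_ℝ : ℂ)) *
      ψ (z.1 - (2⁻¹ : ℝ) • ξ) * conj (φ (z.1 + (2⁻¹ : ℝ) • ξ))

/-- The fractional cross Wigner function `W^θ(ψ,φ) = (2π)^{-n/2} U(θ)(ψ ⊗ conj φ̂)`. -/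
def fWig (n : ℕ) (θ : ℝ) (ψ φ : En n → ℂ) (z : En n × En n) : ℂ :=
  (((2 * Real.pi) ^ (-(n : ℝ) / 2) : ℝ) : ℂ) *
    Uop n θ (fun w => ψ w.1 * conj (FT n φ w.2)) z

/-- Inverse Fourier transform of a kernel in its second variable. -/
def GK (n : ℕ) (K : En n × En n → ℂ) (z : En n × En n) : ℂ :=
  (((2 * Real.pi) ^ (-(n : ℝ) / 2) : ℝ) : ℂ) *
    ∫ y : En n, Complex.exp (Complex.I * (⟪z.2, y⟫_ℝ : ℂ)) * K (z.1, y)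

/-- The Weyl pseudo-differential operator with symbol `a`. -/
def OpW (n : ℕ) (a : En n × En n → ℂ) (ψ : En n → ℂ) (x : En n) : ℂ :=
  (((2 * Real.pi) ^ (-(n : ℝ)) : ℝ) : ℂ) *
    ∫ w : En n × En n, Complex.exp (Complex.I * (⟪x - w.1, w.2⟫_ℝ : ℂ)) *
      a ((2⁻¹ : ℝ) • (x + w.1), w.2) * ψ w.1

/-- The phase-space extension `Â` of the Weyl operator with symbol `a`. -/
def hatA (n : ℕ) (a : En n × En n → ℂ) (Ψ : En n × En n → ℂ) (z : En n × En n) : ℂ :=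
  (((2 * Real.pi) ^ (-(n : ℝ)) : ℝ) : ℂ) *
    ∫ w : En n × En n, Complex.exp (Complex.I * (⟪z.1 - w.1, w.2⟫_ℝ : ℂ)) *
      a ((2⁻¹ : ℝ) • (z.1 + w.1), w.2) * Ψ (w.1, z.2)

open scoped FourierTransform

/-- The unitary inverse Fourier transform `(2π)^{-n/2} ∫ e^{i ξ·y} g(ξ) dξ`. -/
def invFT (n : ℕ) (g : En n → ℂ) (y : En n) : ℂ :=
  (((2 * Real.pi) ^ (-(n : ℝ) / 2) : ℝ) : ℂ) *
    ∫ ξ : En n, Complex.exp (Complex.I * (⟪ξ, y⟫_ℝ : ℂ)) * g ξ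

lemma F2_eq_FT (n : ℕ) (Ψ : En n × En n → ℂ) (z : En n × En n) :
    F2 n Ψ z = FT n (fun p => Ψ (z.1, p)) z.2 := rfl

lemma F2inv_eq_invFT (n : ℕ) (Ψ : En n × En n → ℂ) (z : En n × En n) :
    F2inv n Ψ z = invFT n (fun ξ => Ψ (z.1, ξ)) z.2 := rfl

lemma FT_const_mul (n : ℕ) (a : ℂ) (f : En n → ℂ) (p : En n) :
    FT n (fun y => a * f y) p = a * FT n f p := by
  simp only [FT, mul_left_comm _ a, integral_const_mul]

lemma invFT_const_mul (n : ℕ) (a : ℂ) (f : En n → ℂ) (p : En n) :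
    invFT n (fun y => a * f y) p = a * invFT n f p := by
  simp only [invFT, mul_left_comm _ a, integral_const_mul]

lemma FT_conj (n : ℕ) (f : En n → ℂ) (p : En n) :
    FT n (fun y => conj (f y)) p = conj (invFT n f p) := by
  simp only [FT, invFT, map_mul, Complex.conj_ofReal, ← integral_conj, ← Complex.exp_conj,
    Complex.conj_I, neg_mul, real_inner_comm]

lemma invFT_conj (n : ℕ) (f : En n → ℂ) (p : En n) :
    invFT n (fun y => conj (f y)) p = conj (FT n f p) := by
  simp only [FT, invFT, map_mul, Complex.conj_ofReal, ← integral_conj, ← Complex.exp_conj,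
    Complex.conj_I, neg_mul, real_inner_comm, map_neg, neg_neg]

lemma invFT_eq_FT_neg (n : ℕ) (f : En n → ℂ) (p : En n) :
    invFT n f p = FT n f (-p) := by
  simp only [FT, invFT, inner_neg_left, Complex.ofReal_neg, mul_neg, neg_neg, real_inner_comm]

lemma FT_eq_fourier (n : ℕ) (f : En n → ℂ) (p : En n) :
    FT n f p = (((2 * π) ^ (-(n : ℝ) / 2) : ℝ) : ℂ) * 𝓕 f ((2 * π)⁻¹ • p) := by
  rw [FT, Real.fourier_eq']
  congr 1
  refine integral_congr_ae (.of_forall fun y => ?_)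
  simp only [smul_eq_mul, inner_smul_right, real_inner_comm]
  congr 2
  have : (π : ℂ) ≠ 0 := by exact_mod_cast Real.pi_ne_zero
  push_cast
  field_simp

lemma two_pi_rpow_mul_self (n : ℕ) :
    ((2 * π) ^ (-(n : ℝ) / 2) : ℝ) * ((2 * π) ^ (-(n : ℝ) / 2) : ℝ) * (2 * π) ^ n = 1 := by
  have h : (0 : ℝ) < 2 * π := by positivity
  rw [← Real.rpow_natCast, ← Real.rpow_add h, ← Real.rpow_add h]
  ring_nf
  simp

lemma integral_comp_inv_two_pi_smul {F : Type*} [NormedAddCommGroup F] [NormedSpace ℝ F]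
    (n : ℕ) (f : En n → F) :
    ∫ p, f ((2 * π)⁻¹ • p) = (2 * π) ^ n • ∫ p, f p := by
  have h : (0 : ℝ) ≤ 2 * π := by positivity
  simpa using Measure.integral_comp_inv_smul_of_nonneg volume f h

lemma invFT_FT (n : ℕ) (f : SchwartzMap (En n) ℂ) (x : En n) :
    invFT n (FT n f) x = f x := by
  have key : 𝓕⁻ (𝓕 (f : En n → ℂ)) x = f x := by
    rw [← SchwartzMap.fourier_coe, ← SchwartzMap.fourierInv_coe,
      FourierTransform.fourierInv_fourier_eq]
  rw [Real.fourierInv_eq'] at key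
  have h := integral_comp_inv_two_pi_smul n
    (fun v => Complex.exp (↑(2 * π * ⟪v, x⟫_ℝ) * Complex.I) • 𝓕 (f : En n → ℂ) v)
  rw [key] at h
  rw [invFT]
  have e : ∀ p : En n, Complex.exp (Complex.I * (⟪p, x⟫_ℝ : ℂ)) * FT n f p
      = (((2 * π) ^ (-(n : ℝ) / 2) : ℝ) : ℂ) *
        (Complex.exp (↑(2 * π * ⟪(2 * π)⁻¹ • p, x⟫_ℝ) * Complex.I) •
          𝓕 (f : En n → ℂ) ((2 * π)⁻¹ • p)) := by
    intro p
    have hπ : 2 * π * ((2 * π)⁻¹ * ⟪p, x⟫_ℝ) = ⟪p, x⟫_ℝ := by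
      have := Real.pi_ne_zero
      field_simp
    rw [FT_eq_fourier, real_inner_smul_left, hπ, smul_eq_mul, mul_comm Complex.I]
    ring
  simp only [e, integral_const_mul]
  rw [h, Complex.real_smul, ← mul_assoc, ← mul_assoc]
  have := two_pi_rpow_mul_self n
  rw [← Complex.ofReal_mul, ← Complex.ofReal_mul, this, Complex.ofReal_one, one_mul]

lemma FT_invFT (n : ℕ) (f : SchwartzMap (En n) ℂ) (x : En n) :
    FT n (invFT n f) x = f x := by
  rw [← invFT_FT n f x]
  have : FT n (invFT n f) x = FT n (fun p => FT n f (-p)) x := by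
    congr 1; ext p; exact invFT_eq_FT_neg n f p
  rw [this, FT, invFT, ← integral_neg_eq_self]
  simp [real_inner_comm]

lemma integral_FT_mul_conj_FT (n : ℕ) (φ : SchwartzMap (En n) ℂ) :
    ∫ p, FT n φ p * conj (FT n φ p) = ((∫ x, ‖φ x‖ ^ 2 : ℝ) : ℂ) := by
  have h := integral_comp_inv_two_pi_smul n (fun v => ‖𝓕 φ v‖ ^ 2)
  rw [SchwartzMap.integral_norm_sq_fourier] at h
  simp only [Complex.mul_conj, Complex.normSq_eq_norm_sq]
  rw [integral_complex_ofReal]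
  congr 1
  simp only [FT_eq_fourier, norm_mul, Complex.norm_real, mul_pow, integral_const_mul]
  rw [← SchwartzMap.fourier_coe, h, smul_eq_mul, ← mul_assoc, Real.norm_eq_abs, sq_abs, sq,
    two_pi_rpow_mul_self, one_mul]

/-- The determinant of the flow matrix is one. -/
lemma Mflow_det (s c : ℝ) (h : c ^ 2 + s ^ 2 = 1) :
    (c - (√7)⁻¹ * s) * (c + (√7)⁻¹ * s) + (2 * (√7)⁻¹ * s) * (4 * (√7)⁻¹ * s) = 1 := by
  have h7 : (√7)⁻¹ ^ 2 = (7 : ℝ)⁻¹ := by rw [inv_pow, Real.sq_sqrt (by norm_num)]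
  linear_combination h + 7 * s ^ 2 * h7

lemma Mflow_neg_Mflow (n : ℕ) (θ : ℝ) (z : En n × En n) :
    Mflow n (-θ) (Mflow n θ z) = z := by
  have hd := Mflow_det _ _ (Real.cos_sq_add_sin_sq (√7 * θ))
  ext1
  · simp only [Mflow, mul_neg, Real.cos_neg, Real.sin_neg]
    match_scalars
    · linear_combination hd
    · ring
  · simp only [Mflow, mul_neg, Real.cos_neg, Real.sin_neg]
    match_scalars
    · ring
    · linear_combination hd

/-- Composition of a Schwartz function with a nondegenerate dilation followed by a translation. -/
lemma exists_schwartz_comp_affine (n : ℕ) (f : SchwartzMap (En n) ℂ) (u : En n) {b : ℝ}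
    (hb : b ≠ 0) : ∃ g : SchwartzMap (En n) ℂ, ∀ ξ, g ξ = f (u + b • ξ) :=
  ⟨compCLMOfContinuousLinearEquiv ℂ (ContinuousLinearEquiv.smulLeft (Units.mk0 b hb))
    (compSubConstCLM ℂ (-u) f), fun ξ => by simp [add_comm, Units.smul_def]⟩

lemma exists_schwartz_slice (n : ℕ) (f g : SchwartzMap (En n) ℂ) (u v : En n) {b d : ℝ}
    (h : b ≠ 0 ∨ d ≠ 0) :
    ∃ S : SchwartzMap (En n) ℂ, ∀ ξ, S ξ = f (u + b • ξ) * conj (g (v + d • ξ)) := by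
  have hconj : (fun w : ℂ => conj w).HasTemperateGrowth :=
    Complex.conjCLE.toContinuousLinearMap.hasTemperateGrowth
  have haff : ∀ (w : En n) (r : ℝ), (fun ξ : En n => w + r • ξ).HasTemperateGrowth := by
    intro w r
    fun_prop
  rcases h with hb | hd
  · obtain ⟨F, hF⟩ := exists_schwartz_comp_affine n f u hb
    have hg : (fun ξ => conj (g (v + d • ξ))).HasTemperateGrowth :=
      hconj.comp (g.hasTemperateGrowth.comp (haff v d))
    exact ⟨smulLeftCLM ℂ (fun ξ => conj (g (v + d • ξ))) F, fun ξ => by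
      rw [smulLeftCLM_apply_apply hg, hF, smul_eq_mul, mul_comm]⟩
  · obtain ⟨G, hG⟩ := exists_schwartz_comp_affine n g v hd
    have hf : (fun ξ => f (u + b • ξ)).HasTemperateGrowth :=
      f.hasTemperateGrowth.comp (haff u b)
    exact ⟨smulLeftCLM ℂ (fun ξ => f (u + b • ξ))
      (postcompCLM Complex.conjCLE.toContinuousLinearMap G), fun ξ => by
        rw [smulLeftCLM_apply_apply hf, smul_eq_mul]
        simp [hG]⟩

lemma exists_schwartz_Mflow_slice (n : ℕ) (θ : ℝ) (f g : SchwartzMap (En n) ℂ) (x : En n) :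
    ∃ S : SchwartzMap (En n) ℂ, ∀ ξ,
      S ξ = f (Mflow n θ (x, ξ)).1 * conj (g (Mflow n θ (x, ξ)).2) := by
  simp only [Mflow]
  refine exists_schwartz_slice n f g _ _ ?_
  by_contra! h
  have hd := Mflow_det _ _ (Real.cos_sq_add_sin_sq (√7 * θ))
  rw [h.1, h.2] at hd
  simp at hd

lemma F2_tensor_conj_FT (n : ℕ) (φ ψ : SchwartzMap (En n) ℂ) (z : En n × En n) :
    F2 n (fun w => ψ w.1 * conj (FT n φ w.2)) z = ψ z.1 * conj (φ z.2) := by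
  rw [F2_eq_FT]
  dsimp only
  rw [FT_const_mul, FT_conj, invFT_FT]

lemma F2_Uop_tensor (n : ℕ) (θ : ℝ) (φ ψ : SchwartzMap (En n) ℂ) (z : En n × En n) :
    F2 n (Uop n θ (fun w => ψ w.1 * conj (FT n φ w.2))) z
      = ψ (Mflow n (-θ) z).1 * conj (φ (Mflow n (-θ) z).2) := by
  obtain ⟨S, hS⟩ := exists_schwartz_Mflow_slice n (-θ) ψ φ z.1
  have h : (fun p => Uop n θ (fun w => ψ w.1 * conj (FT n φ w.2)) (z.1, p)) = invFT n S := by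
    ext p
    rw [Uop, F2inv_eq_invFT]
    simp only [F2_tensor_conj_FT, ← hS]
  rw [F2_eq_FT, h, FT_invFT, hS]

lemma Uop_neg_Uop_tensor (n : ℕ) (θ : ℝ) (φ ψ : SchwartzMap (En n) ℂ) (z : En n × En n) :
    Uop n (-θ) (Uop n θ (fun w => ψ w.1 * conj (FT n φ w.2))) z
      = ψ z.1 * conj (FT n φ z.2) := by
  rw [Uop, F2inv_eq_invFT]
  simp only [F2_Uop_tensor, neg_neg, Mflow_neg_Mflow]
  rw [invFT_const_mul, invFT_conj]

/-- Inversion formula for the fractional windowed Wigner transform: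
`(W^θ_φ)^* W^θ_φ ψ = ψ` for a normalized Schwartz window `φ`. -/
theorem statement11 (n : ℕ) (θ : ℝ) (φ ψ : SchwartzMap (En n) ℂ)
    (hφ : ∫ x : En n, ‖φ x‖ ^ 2 = 1) (x : En n) :
    (∫ p : En n, FT n (⇑φ) p *
        Uop n (-θ) (Uop n θ (fun w => ψ w.1 * conj (FT n (⇑φ) w.2))) (x, p))
      = ψ x := by
  simp only [Uop_neg_Uop_tensor]
  have h : ∀ p : En n, FT n φ p * (ψ x * conj (FT n φ p)) =
      ψ x * (FT n φ p * conj (FT n φ p)) := fun p => by ring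
  simp only [h, integral_const_mul]
  rw [integral_FT_mul_conj_FT, hφ, Complex.ofReal_one, mul_one]
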